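/- Planar graph amplitude Γ₄: for all real p₁ ≥ 0 and p₂ > 0 with p₁ ≠ p₂, the double integral over [0,∞)² of 1/((1+q₁+q₂)(1+p₁+q₁)(1+p₂+q₁)²(1+p₂+q₂)) dq₁ dq₂ converges and equals −Li₂(−p₂)/((1+2p₂)²(1+p₁+p₂)) − (π²/6 − log²(1+p₂) − Li₂(−p₂))/((1+2p₂)(p₁−p₂)²) + (π²/6 − log²(1+p₂) − Li₂(−p₂))/((1+2p₂)²(p₁−p₂)) + (π²/6 − log(1+p₂)log(1+p₁) − Li₂(−p₁))/((1+p₁+p₂)(p₁−p₂)²) − log(1+p₂)/(p₂(1+p₂)(1+2p₂)(p₁−p₂)). -/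

import Mathlib

open MeasureTheory Real

/-- The real dilogarithm, `Li₂(x) = −∫₀ˣ log(1−u)/u du`. -/
noncomputable def Li2 (x : ℝ) : ℝ := -∫ u in (0:ℝ)..x, Real.log (1 - u) / u

open Set Filter Topology

/-- The continuous extension of `-log(1-u)/u`. -/
noncomputable def ell (x : ℝ) : ℝ := if x = 0 then 1 else -Real.log (1 - x) / x

lemma ell_mul (x : ℝ) : x * ell x = -Real.log (1 - x) := by
  unfold ell
  split_ifs with h
  · simp [h]
  · field_simp

lemma ell_eq_dslope : ell = dslope (fun x : ℝ => -Real.log (1 - x)) 0 := by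
  funext x
  by_cases h : x = 0
  · subst h
    rw [dslope_same]
    have : HasDerivAt (fun x : ℝ => -Real.log (1 - x)) (-((0 - 1) / (1 - 0))) (0:ℝ) := by
      have h1 : HasDerivAt (fun x : ℝ => 1 - x) (0 - 1) (0:ℝ) :=
        (hasDerivAt_const _ _).sub (hasDerivAt_id _)
      exact (h1.log (by norm_num)).neg
    rw [this.deriv]
    simp [ell]
  · rw [dslope_of_ne _ h, slope_def_field]
    simp [ell, h]

lemma ell_continuousOn : ContinuousOn ell (Iio 1) := by
  rw [ell_eq_dslope, continuousOn_dslope (Iio_mem_nhds (by norm_num))]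
  constructor
  · apply ContinuousOn.neg
    apply ContinuousOn.log (by fun_prop)
    intro x hx
    have : x < 1 := hx
    linarith
  · have h1 : HasDerivAt (fun x : ℝ => 1 - x) (0 - 1) (0:ℝ) :=
      (hasDerivAt_const _ _).sub (hasDerivAt_id _)
    exact (h1.log (by norm_num)).neg.differentiableAt

lemma Li2_eq (x : ℝ) : Li2 x = ∫ u in (0:ℝ)..x, ell u := by
  unfold Li2
  rw [← intervalIntegral.integral_neg]
  apply intervalIntegral.integral_congr_ae
  have : ∀ᵐ u : ℝ, u ≠ 0 := by
    simp [ae_iff]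
  filter_upwards [this] with u hu _
  simp [ell, hu, neg_div]

lemma hasDerivAt_Li2 {x : ℝ} (hx : x < 1) : HasDerivAt Li2 (ell x) x := by
  have : Li2 = fun x => ∫ u in (0:ℝ)..x, ell u := funext Li2_eq
  rw [this]
  apply intervalIntegral.integral_hasDerivAt_right
  · apply ContinuousOn.intervalIntegrable
    apply ell_continuousOn.mono
    intro y hy
    have := hy.2
    simp only [mem_Iio]
    exact lt_of_le_of_lt this (max_lt (by norm_num) hx)
  · exact ell_continuousOn.stronglyMeasurableAtFilter isOpen_Iio x hx
  · exact ell_continuousOn.continuousAt (Iio_mem_nhds hx)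

lemma Li2_zero : Li2 0 = 0 := by simp [Li2]

lemma ell_nonneg {x : ℝ} (hx : x < 1) : 0 ≤ ell x := by
  unfold ell
  split_ifs with h
  · norm_num
  · rcases lt_or_gt_of_ne h with h | h
    · apply div_nonneg_of_nonpos _ h.le
      have := Real.log_nonneg (show 1 ≤ 1 - x by linarith)
      linarith
    · apply div_nonneg _ h.le
      have := Real.log_nonpos (show 0 ≤ 1 - x by linarith) (by linarith)
      linarith

lemma const_Ioi {f : ℝ → ℝ} {c : ℝ} (hf : ∀ x ∈ Ioi c, HasDerivAt f 0 x) {x y : ℝ}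
    (hx : c < x) (hy : c < y) : f x = f y := by
  apply isOpen_Ioi.is_const_of_deriv_eq_zero (s := Ioi c) isPreconnected_Ioi
    (fun z hz => (hf z hz).differentiableAt.differentiableWithinAt)
    (fun z hz => (hf z hz).deriv) hx hy

lemma landen {P : ℝ} (hP : 0 ≤ P) : Li2 (P / (1 + P)) = -Li2 (-P) - Real.log (1 + P) ^ 2 / 2 := by
  have key : ∀ x ∈ Ioi (-1:ℝ), HasDerivAt
      (fun P => Li2 (P / (1 + P)) + Li2 (-P) + Real.log (1 + P) ^ 2 / 2) 0 x := by
    intro x hx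
    have hx : 0 < 1 + x := by have : -1 < x := hx; linarith
    have e : 1 - x / (1 + x) = (1 + x)⁻¹ := by field_simp; ring
    have h1 : HasDerivAt (fun P : ℝ => 1 + P) 1 x := (hasDerivAt_id x).const_add 1
    have h2 : HasDerivAt (fun P : ℝ => P / (1 + P)) ((1 * (1 + x) - x * 1) / (1 + x) ^ 2) x :=
      (hasDerivAt_id x).div h1 hx.ne'
    have hlt : x / (1 + x) < 1 := by rw [div_lt_one hx]; linarith
    have h3 := (hasDerivAt_Li2 hlt).comp x h2
    have h4 := (hasDerivAt_Li2 (show -x < 1 by linarith)).comp x (hasDerivAt_neg x)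
    have h5 := ((h1.log hx.ne').pow 2).div_const 2
    refine ((h3.add h4).add h5).congr_deriv ?_
    by_cases h0 : x = 0
    · subst h0; simp [ell]
    · simp only [ell, h0, e, Real.log_inv, div_eq_zero_iff, hx.ne', neg_eq_zero, or_self, if_false]
      simp only [sub_neg_eq_add]
      field_simp
      ring
  have := const_Ioi key (show -1 < P by linarith) (show (-1:ℝ) < 0 by norm_num)
  simp [Li2_zero] at this
  linarith

lemma altsum : HasSum (fun n : ℕ => (-1:ℝ) ^ n / ((n:ℝ) + 1) ^ 2) (π ^ 2 / 12) := by
  have h := hasSum_one_div_nat_pow_mul_cos one_ne_zero (x := 1/2) ⟨by norm_num, by norm_num⟩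
  rw [← hasSum_nat_add_iff' 1] at h
  have h := h.neg
  convert! h using 1
  · funext n
    have : 2 * π * ((n + 1 : ℕ) : ℝ) * (1/2) = (n + 1 : ℕ) * π := by push_cast; ring
    rw [this, Real.cos_nat_mul_pi, pow_succ]
    push_cast
    ring
  · have : Polynomial.eval (1 / 2 : ℝ) (Polynomial.map (algebraMap ℚ ℝ) (Polynomial.bernoulli 2))
        = -1 / 12 := by
      rw [Polynomial.bernoulli]
      simp [Finset.sum_range_succ, bernoulli_eq_bernoulli'_of_ne_one]
      norm_num [bernoulli_one, bernoulli_two]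
    rw [mul_one, this]
    simp [Nat.factorial]
    ring

lemma Li2_neg_one : Li2 (-1) = -(π ^ 2 / 12) := by
  have hs : ∀ n : ℕ, ∫ t in Ioc (0:ℝ) 1, t ^ n / ((n:ℝ) + 1) = 1 / ((n:ℝ) + 1) ^ 2 := by
    intro n
    rw [← intervalIntegral.integral_of_le (by norm_num), intervalIntegral.integral_div,
      integral_pow]
    simp
    field_simp
  have H := hasSum_integral_of_summable_integral_norm (μ := volume.restrict (Ioc (0:ℝ) 1))
    (F := fun (n : ℕ) (t : ℝ) => (-1) ^ n * (t ^ n / ((n:ℝ) + 1))) (fun n => by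
      apply IntegrableOn.integrable
      rw [← intervalIntegrable_iff_integrableOn_Ioc_of_le (by norm_num)]
      apply Continuous.intervalIntegrable
      fun_prop) (by
      have e : ∀ n : ℕ, ∫ t in Ioc (0:ℝ) 1, ‖(-1:ℝ) ^ n * (t ^ n / ((n:ℝ) + 1))‖
          = 1 / ((n:ℝ) + 1) ^ 2 := by
        intro n
        rw [← hs n]
        apply setIntegral_congr_fun measurableSet_Ioc
        intro t ht
        have : 0 < t := ht.1
        simp only [norm_mul, norm_pow, norm_neg, norm_one, one_pow, one_mul]
        exact abs_of_nonneg (by positivity)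
      simp_rw [e]
      have := (summable_nat_add_iff 1).2 (Real.summable_one_div_nat_pow (p := 2).2 (by norm_num))
      simpa using this)
  have e2 : ∀ n : ℕ, ∫ t in Ioc (0:ℝ) 1, (-1:ℝ) ^ n * (t ^ n / ((n:ℝ) + 1))
      = (-1) ^ n / ((n:ℝ) + 1) ^ 2 := by
    intro n
    rw [integral_const_mul, hs n]
    ring
  simp_rw [e2] at H
  have H2 := H.unique altsum
  rw [← H2, Li2_eq, intervalIntegral.integral_symm]
  rw [show ∫ u in (-1:ℝ)..0, ell u = ∫ u in (0:ℝ)..1, ell (-u) by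
    rw [intervalIntegral.integral_comp_neg]; simp]
  rw [intervalIntegral.integral_of_le (by norm_num)]
  congr 1
  have h1 : ∀ᵐ t : ℝ, t ≠ 1 := by simp [ae_iff]
  apply setIntegral_congr_ae measurableSet_Ioc
  filter_upwards [h1] with t ht1 ht
  have ht0 : 0 < t := ht.1
  have ht2 : t < 1 := lt_of_le_of_ne ht.2 ht1
  have h3 := (Real.hasSum_pow_div_log_of_abs_lt_one (x := -t)
    (by rw [abs_neg, abs_of_pos ht0]; exact ht2)).div_const (-t)
  have h4 : ell (-t) = -Real.log (1 - -t) / -t := by simp [ell, ht0.ne']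
  rw [h4, ← h3.tsum_eq]
  congr 1
  funext n
  rw [pow_succ, neg_pow t n]
  field_simp

lemma inversion {y : ℝ} (hy : 0 < y) :
    Li2 (-y) = -(π ^ 2 / 6) - Real.log y ^ 2 / 2 - Li2 (-(1 / y)) := by
  have key : ∀ x ∈ Ioi (0:ℝ), HasDerivAt
      (fun y => Li2 (-y) + Li2 (-y⁻¹) + Real.log y ^ 2 / 2) 0 x := by
    intro x hx
    have hx : 0 < x := hx
    have hxi : 0 < x⁻¹ := inv_pos.2 hx
    have e : 1 - -x⁻¹ = (1 - -x) / x := by field_simp; ring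
    have h3 := (hasDerivAt_Li2 (show -x⁻¹ < 1 by linarith)).comp x (hasDerivAt_inv hx.ne').neg
    have h4 := (hasDerivAt_Li2 (show -x < 1 by linarith)).comp x (hasDerivAt_neg x)
    have h5 := (((hasDerivAt_log hx.ne')).pow 2).div_const 2
    refine ((h4.add h3).add h5).congr_deriv ?_
    simp only [ell, e, neg_eq_zero, hx.ne', hxi.ne', if_false]
    rw [Real.log_div (by linarith) hx.ne']
    field_simp
    ring
  have := const_Ioi key hy (show (0:ℝ) < 1 by norm_num)
  simp [Li2_neg_one] at this
  rw [one_div]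
  linarith

/-- The inner integral. -/
noncomputable def Lin (P q : ℝ) : ℝ := ell ((P - q) / (1 + P)) / (1 + P)

noncomputable def FA (P q : ℝ) : ℝ := -Li2 ((P - q) / (1 + P))

noncomputable def FB (P a q : ℝ) : ℝ :=
  Real.log (1 + P) * Real.log (1 + a + q) - (Real.log (1 + q) * Real.log (1 + a + q)
    - Real.log (1 + q) ^ 2 / 2 - Li2 (-a / (1 + q)))

noncomputable def FD (P q : ℝ) : ℝ :=
  -(Real.log (1 + P) - Real.log (1 + q)) / (1 + P + q)
    - (Real.log (1 + q) - Real.log (1 + P + q)) / P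

lemma arg_lt {P q : ℝ} (hP : 0 < P) (hq : 0 ≤ q) : (P - q) / (1 + P) < 1 := by
  rw [div_lt_one (by linarith)]; linarith

lemma Lin_nonneg {P q : ℝ} (hP : 0 < P) (hq : 0 ≤ q) : 0 ≤ Lin P q :=
  div_nonneg (ell_nonneg (arg_lt hP hq)) (by linarith)

lemma Lin_mul {P q : ℝ} (hP : 0 < P) (hq : 0 ≤ q) :
    (P - q) * Lin P q = Real.log (1 + P) - Real.log (1 + q) := by
  have h := ell_mul ((P - q) / (1 + P))
  have e : 1 - (P - q) / (1 + P) = (1 + q) / (1 + P) := by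
    field_simp; ring
  rw [e, Real.log_div (by linarith) (by linarith)] at h
  unfold Lin
  rw [← neg_sub (Real.log (1 + q)), ← h]
  ring

lemma hasDerivAt_FA {P q : ℝ} (hP : 0 < P) (hq : 0 ≤ q) : HasDerivAt (FA P) (Lin P q) q := by
  have h1 : HasDerivAt (fun q : ℝ => (P - q) / (1 + P)) (-1 / (1 + P)) q :=
    ((hasDerivAt_id q).const_sub P).div_const _
  refine ((hasDerivAt_Li2 (arg_lt hP hq)).comp q h1).neg.congr_deriv ?_
  unfold Lin
  ring

lemma hasDerivAt_FB {P a q : ℝ} (ha : 0 ≤ a) (hq : 0 ≤ q) :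
    HasDerivAt (FB P a) ((Real.log (1 + P) - Real.log (1 + q)) / (1 + a + q)) q := by
  have hs : 0 < 1 + q := by linarith
  have hs2 : 0 < 1 + a + q := by linarith
  have h1 : HasDerivAt (fun q : ℝ => 1 + q) 1 q := (hasDerivAt_id q).const_add 1
  have h2 : HasDerivAt (fun q : ℝ => 1 + a + q) 1 q := (hasDerivAt_id q).const_add (1 + a)
  have l1 := h1.log hs.ne'
  have l2 := h2.log hs2.ne'
  have h3 : HasDerivAt (fun q : ℝ => -a / (1 + q)) ((0 * (1 + q) - (-a) * 1) / (1 + q) ^ 2) q :=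
    (hasDerivAt_const q (-a)).div h1 hs.ne'
  have hlt : -a / (1 + q) < 1 := by rw [div_lt_one hs]; linarith
  have h4 := (hasDerivAt_Li2 hlt).comp q h3
  have em := ell_mul (-a / (1 + q))
  have e : 1 - -a / (1 + q) = (1 + a + q) / (1 + q) := by field_simp; ring
  rw [e, Real.log_div hs2.ne' hs.ne'] at em
  have e5 : ell (-a / (1 + q)) * ((0 * (1 + q) - (-a) * 1) / (1 + q) ^ 2)
      = (Real.log (1 + a + q) - Real.log (1 + q)) / (1 + q) := by
    rw [← neg_eq_iff_eq_neg] at em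
    rw [← em]
    field_simp
    ring
  rw [e5] at h4
  refine ((l2.const_mul (Real.log (1 + P))).sub
    (((l1.mul l2).sub ((l1.pow 2).div_const 2)).sub h4)).congr_deriv ?_
  field_simp
  ring

lemma hasDerivAt_FD {P q : ℝ} (hP : 0 < P) (hq : 0 ≤ q) :
    HasDerivAt (FD P) ((Real.log (1 + P) - Real.log (1 + q)) / (1 + P + q) ^ 2) q := by
  have hs : 0 < 1 + q := by linarith
  have hs2 : 0 < 1 + P + q := by linarith
  have h1 : HasDerivAt (fun q : ℝ => 1 + q) 1 q := (hasDerivAt_id q).const_add 1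
  have h2 : HasDerivAt (fun q : ℝ => 1 + P + q) 1 q := (hasDerivAt_id q).const_add (1 + P)
  have l1 := h1.log hs.ne'
  have l2 := h2.log hs2.ne'
  refine (((l1.const_sub (Real.log (1 + P))).neg.div h2 hs2.ne').sub
    ((l1.sub l2).div_const P)).congr_deriv ?_
  simp only [Pi.neg_apply]
  field_simp
  ring

lemma tendsto_div_add (c d : ℝ) : Tendsto (fun q : ℝ => c / (d + q)) atTop (𝓝 0) :=
  tendsto_const_nhds.div_atTop (tendsto_atTop_add_const_left _ _ tendsto_id)

lemma tendsto_log_mul (c : ℝ) :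
    Tendsto (fun s : ℝ => Real.log s * Real.log (1 + c / s)) atTop (𝓝 0) := by
  have h1 : Tendsto (fun s : ℝ => Real.log s / s) atTop (𝓝 0) :=
    Real.isLittleO_log_id_atTop.tendsto_div_nhds_zero
  have h2 := h1.mul (Real.tendsto_mul_log_one_add_div_atTop c)
  rw [zero_mul] at h2
  refine h2.congr' ?_
  filter_upwards [eventually_gt_atTop 0] with s hs
  field_simp

lemma tendsto_log_one (c : ℝ) :
    Tendsto (fun s : ℝ => Real.log (1 + c / s)) atTop (𝓝 0) := by
  have h1 : Tendsto (fun s : ℝ => 1 + c / s) atTop (𝓝 (1 + 0)) :=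
    tendsto_const_nhds.add (tendsto_const_nhds.div_atTop tendsto_id)
  have := h1.log (by norm_num)
  simpa using this

lemma log_split {c s : ℝ} (hs : 0 < s) (h : 0 < s + c) :
    Real.log (s + c) = Real.log s + Real.log (1 + c / s) := by
  have : 0 < 1 + c / s := by
    have : 1 + c / s = (s + c) / s := by field_simp
    rw [this]; positivity
  rw [← Real.log_mul hs.ne' this.ne']
  congr 1
  field_simp

lemma tendsto_Li2_zero {f : ℝ → ℝ} (hf : Tendsto f atTop (𝓝 0)) :
    Tendsto (fun q => Li2 (f q)) atTop (𝓝 0) := by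
  have h : Tendsto Li2 (𝓝 0) (𝓝 (Li2 0)) :=
    (hasDerivAt_Li2 (by norm_num : (0:ℝ) < 1)).continuousAt
  rw [Li2_zero] at h
  exact h.comp hf

lemma tendsto_FAB {P a : ℝ} (hP : 0 < P) (ha : 0 ≤ a) :
    Tendsto (fun q => FA P q + FB P a q) atTop (𝓝 (π ^ 2 / 6 + Real.log (1 + P) ^ 2 / 2)) := by
  have ht : Tendsto (fun q : ℝ => 1 + q) atTop atTop :=
    tendsto_atTop_add_const_left _ _ tendsto_id
  have x1 := (tendsto_log_mul (-(1 + P))).comp ht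
  have x2 := (tendsto_log_mul a).comp ht
  have y1 := (tendsto_log_one (-(1 + P))).comp ht
  have y2 := (tendsto_log_one a).comp ht
  have z1 := tendsto_Li2_zero (tendsto_div_add (-(1 + P)) (-P))
  have z2 := tendsto_Li2_zero (tendsto_div_add (-a) 1)
  have H := (((((((tendsto_const_nhds (x := π ^ 2 / 6 + Real.log (1 + P) ^ 2 / 2)
    (f := atTop)).add x1).add ((y1.pow 2).div_const 2)).sub
    (y1.const_mul (Real.log (1 + P)))).add (y2.const_mul (Real.log (1 + P)))).sub x2).add z1).add z2
  simp only [ne_eq, OfNat.ofNat_ne_zero, not_false_eq_true, zero_pow, zero_div, add_zero, mul_zero,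
    sub_zero] at H
  refine H.congr' ?_
  filter_upwards [eventually_gt_atTop P] with q hq
  have hq0 : 0 < 1 + q := by linarith
  have i1 := inversion (y := (q - P) / (1 + P)) (div_pos (by linarith) (by linarith))
  have e1 : -((q - P) / (1 + P)) = (P - q) / (1 + P) := by ring
  have e2 : -(1 / ((q - P) / (1 + P))) = -(1 + P) / (-P + q) := by
    rw [one_div_div, neg_div, neg_add_eq_sub]
  rw [e1, e2, Real.log_div (by linarith) (by linarith)] at i1
  have s1 := log_split (c := -(1 + P)) hq0 (by linarith)
  have s2 := log_split (c := a) hq0 (by linarith)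
  rw [show 1 + q + -(1 + P) = q - P by ring] at s1
  rw [show 1 + q + a = 1 + a + q by ring] at s2
  simp only [Function.comp, FA, FB]
  rw [i1, s1, s2]
  ring

lemma tendsto_FD {P : ℝ} (hP : 0 < P) : Tendsto (FD P) atTop (𝓝 0) := by
  have ht : Tendsto (fun q : ℝ => 1 + q) atTop atTop :=
    tendsto_atTop_add_const_left _ _ tendsto_id
  have hl : Tendsto (fun s : ℝ => Real.log s / s) atTop (𝓝 0) :=
    Real.isLittleO_log_id_atTop.tendsto_div_nhds_zero
  have ht2 : Tendsto (fun q : ℝ => 1 + P + q) atTop atTop :=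
    tendsto_atTop_add_const_left _ _ tendsto_id
  have h1 := hl.comp ht2
  have h2 := (tendsto_log_one P).comp ht
  have h3 := tendsto_div_add (Real.log (1 + P)) (1 + P)
  have h4 := h2.mul (tendsto_div_add 1 (1 + P))
  have H := ((h1.sub h3).sub h4).add (h2.div_const P)
  simp only [sub_zero, mul_zero, zero_div, add_zero] at H
  refine H.congr' ?_
  filter_upwards [eventually_gt_atTop 0] with q hq
  have s2 := log_split (c := P) (s := 1 + q) (by linarith) (by linarith)
  rw [show 1 + q + P = 1 + P + q by ring] at s2
  simp only [Function.comp, FD]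
  rw [s2]
  field_simp
  ring

lemma inner_int {P q : ℝ} (hP : 0 < P) (hq : 0 ≤ q) :
    IntegrableOn (fun t : ℝ => 1 / ((1 + q + t) * (1 + P + t))) (Ioi 0) ∧
    ∫ t in Ioi (0:ℝ), 1 / ((1 + q + t) * (1 + P + t)) = Lin P q := by
  have pos : ∀ t ∈ Ioi (0:ℝ), 0 ≤ 1 / ((1 + q + t) * (1 + P + t)) := by
    intro t ht
    have : 0 < t := ht
    positivity
  by_cases h : q = P
  · subst h
    have hd : ∀ t ∈ Ici (0:ℝ), HasDerivAt (fun t => -1 / (1 + q + t))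
        (1 / ((1 + q + t) * (1 + q + t))) t := by
      intro t ht
      have : 0 ≤ t := ht
      have h0 : 0 < 1 + q + t := by linarith
      refine ((hasDerivAt_const t (-1:ℝ)).div ((hasDerivAt_id t).const_add (1 + q))
        h0.ne').congr_deriv ?_
      simp; field_simp
    have hl := tendsto_div_add (-1) (1 + q)
    refine ⟨integrableOn_Ioi_deriv_of_nonneg' hd pos hl, ?_⟩
    rw [integral_Ioi_of_hasDerivAt_of_nonneg' hd pos hl]
    simp [Lin, ell]; ring
  · have hne : P - q ≠ 0 := fun h' => h (by linarith)
    have hd : ∀ t ∈ Ici (0:ℝ), HasDerivAt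
        (fun t => (Real.log (1 + q + t) - Real.log (1 + P + t)) / (P - q))
        (1 / ((1 + q + t) * (1 + P + t))) t := by
      intro t ht
      have : 0 ≤ t := ht
      have h0 : 0 < 1 + q + t := by linarith
      have h1 : 0 < 1 + P + t := by linarith
      refine (((((hasDerivAt_id t).const_add (1 + q)).log h0.ne').sub
        (((hasDerivAt_id t).const_add (1 + P)).log h1.ne')).div_const (P - q)).congr_deriv ?_
      simp only [id]
      field_simp
      ring
    have hl : Tendsto (fun t => (Real.log (1 + q + t) - Real.log (1 + P + t)) / (P - q)) atTop
        (𝓝 0) := by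
      have ht : Tendsto (fun t : ℝ => 1 + q + t) atTop atTop :=
        tendsto_atTop_add_const_left _ _ tendsto_id
      have H := (((tendsto_log_one (P - q)).comp ht).neg).div_const (P - q)
      simp only [neg_zero, zero_div] at H
      refine H.congr' ?_
      filter_upwards [eventually_gt_atTop 0] with t h0
      have s2 := log_split (c := P - q) (s := 1 + q + t) (by linarith) (by linarith)
      rw [show 1 + q + t + (P - q) = 1 + P + t by ring] at s2
      simp only [Function.comp]
      rw [s2]
      ring
    refine ⟨integrableOn_Ioi_deriv_of_nonneg' hd pos hl, ?_⟩
    rw [integral_Ioi_of_hasDerivAt_of_nonneg' hd pos hl]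
    have := Lin_mul hP hq
    field_simp
    simp only [add_zero]
    linarith

lemma outer_int {a P : ℝ} (ha : 0 ≤ a) (hP : 0 < P) (hne : a ≠ P) :
    IntegrableOn (fun q : ℝ => 1 / ((1 + a + q) * (1 + P + q) ^ 2) * Lin P q) (Ioi 0) ∧
    ∫ q in Ioi (0:ℝ), 1 / ((1 + a + q) * (1 + P + q) ^ 2) * Lin P q
      = -Li2 (-P) / ((1 + 2 * P) ^ 2 * (1 + a + P))
        - (π ^ 2 / 6 - Real.log (1 + P) ^ 2 - Li2 (-P)) / ((1 + 2 * P) * (a - P) ^ 2)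
        + (π ^ 2 / 6 - Real.log (1 + P) ^ 2 - Li2 (-P)) / ((1 + 2 * P) ^ 2 * (a - P))
        + (π ^ 2 / 6 - Real.log (1 + P) * Real.log (1 + a) - Li2 (-a))
            / ((1 + a + P) * (a - P) ^ 2)
        - Real.log (1 + P) / (P * (1 + P) * (1 + 2 * P) * (a - P)) := by
  have hne' : a - P ≠ 0 := sub_ne_zero.2 hne
  have pos : ∀ q ∈ Ioi (0:ℝ), 0 ≤ 1 / ((1 + a + q) * (1 + P + q) ^ 2) * Lin P q := by
    intro q hq
    have hq : 0 < q := hq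
    have := Lin_nonneg hP hq.le
    positivity
  set A : ℝ := 1 / ((1 + a + P) * (1 + 2 * P) ^ 2) with hA
  set B : ℝ := 1 / ((1 + a + P) * (a - P) ^ 2) with hB
  set D : ℝ := 1 / ((1 + 2 * P) * (a - P)) with hD
  have hd : ∀ q ∈ Ici (0:ℝ), HasDerivAt
      (fun q => B * (FA P q + FB P a q) + (A - B) * (FA P q + FB P P q) + D * FD P q)
      (1 / ((1 + a + q) * (1 + P + q) ^ 2) * Lin P q) q := by
    intro q hq
    have hq : 0 ≤ q := hq
    have d1 := hasDerivAt_FA hP hq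
    have d2 := hasDerivAt_FB (P := P) ha hq
    have d3 := hasDerivAt_FB (P := P) hP.le hq
    have d4 := hasDerivAt_FD hP hq
    rw [← Lin_mul hP hq] at d2 d3 d4
    refine ((((d1.add d2).const_mul B).add ((d1.add d3).const_mul (A - B))).add
      (d4.const_mul D)).congr_deriv ?_
    have h0 : 0 < 1 + a + q := by linarith
    have h1 : 0 < 1 + P + q := by linarith
    have h2 : 0 < 1 + a + P := by linarith
    have h3 : 0 < 1 + 2 * P := by linarith
    rw [hA, hB, hD]
    field_simp
    ring
  have hl := (((tendsto_FAB hP ha).const_mul B).add ((tendsto_FAB hP hP.le).const_mul (A - B))).add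
    ((tendsto_FD hP).const_mul D)
  refine ⟨integrableOn_Ioi_deriv_of_nonneg' hd pos hl, ?_⟩
  rw [integral_Ioi_of_hasDerivAt_of_nonneg' hd pos hl]
  simp only [FA, FB, FD, sub_zero, add_zero, Real.log_one, landen hP.le, div_one]
  have h2 : 0 < 1 + a + P := by linarith
  have h3 : 0 < 1 + 2 * P := by linarith
  rw [hA, hB, hD]
  field_simp
  ring


/-- Planar graph amplitude `Γ₄`. -/
theorem graph_amplitude_Gamma4 (p₁ p₂ : ℝ) (hp₁ : 0 ≤ p₁) (hp₂ : 0 < p₂) (hne : p₁ ≠ p₂) :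
    IntegrableOn
      (fun q : ℝ × ℝ => 1 / ((1 + q.1 + q.2) * (1 + p₁ + q.1) * (1 + p₂ + q.1) ^ 2
        * (1 + p₂ + q.2)))
      (Set.Ici 0 ×ˢ Set.Ici 0) ∧
    ∫ q in (Set.Ici (0:ℝ) ×ˢ Set.Ici (0:ℝ)),
        1 / ((1 + q.1 + q.2) * (1 + p₁ + q.1) * (1 + p₂ + q.1) ^ 2 * (1 + p₂ + q.2))
      = -Li2 (-p₂) / ((1 + 2 * p₂) ^ 2 * (1 + p₁ + p₂))
        - (π ^ 2 / 6 - Real.log (1 + p₂) ^ 2 - Li2 (-p₂)) / ((1 + 2 * p₂) * (p₁ - p₂) ^ 2)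
        + (π ^ 2 / 6 - Real.log (1 + p₂) ^ 2 - Li2 (-p₂)) / ((1 + 2 * p₂) ^ 2 * (p₁ - p₂))
        + (π ^ 2 / 6 - Real.log (1 + p₂) * Real.log (1 + p₁) - Li2 (-p₁))
            / ((1 + p₁ + p₂) * (p₁ - p₂) ^ 2)
        - Real.log (1 + p₂) / (p₂ * (1 + p₂) * (1 + 2 * p₂) * (p₁ - p₂)) := by
  have hmul : ∀ q t : ℝ, 1 / ((1 + q + t) * (1 + p₁ + q) * (1 + p₂ + q) ^ 2 * (1 + p₂ + t))
      = 1 / ((1 + p₁ + q) * (1 + p₂ + q) ^ 2) * (1 / ((1 + q + t) * (1 + p₂ + t))) := by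
    intro q t
    rw [div_mul_div_comm, one_mul]
    congr 1
    ring
  obtain ⟨o1, o2⟩ := outer_int hp₁ hp₂ hne
  have hvol : (volume : Measure (ℝ × ℝ)).restrict (Ici (0:ℝ) ×ˢ Ici (0:ℝ))
      = ((volume : Measure ℝ).restrict (Ioi 0)).prod ((volume : Measure ℝ).restrict (Ioi 0)) := by
    rw [Measure.volume_eq_prod, ← Measure.prod_restrict,
      Measure.restrict_congr_set (Ioi_ae_eq_Ici (a := (0:ℝ)) (μ := volume))]
  have hint : Integrable (fun q : ℝ × ℝ => 1 / ((1 + q.1 + q.2) * (1 + p₁ + q.1)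
      * (1 + p₂ + q.1) ^ 2 * (1 + p₂ + q.2)))
      (((volume : Measure ℝ).restrict (Ioi 0)).prod ((volume : Measure ℝ).restrict (Ioi 0))) := by
    rw [integrable_prod_iff (by
      apply Measurable.aestronglyMeasurable
      fun_prop)]
    constructor
    · filter_upwards [ae_restrict_mem measurableSet_Ioi] with q hq
      simp only [hmul]
      exact (inner_int hp₂ (le_of_lt hq)).1.const_mul _
    · refine o1.congr_fun_ae ?_
      filter_upwards [ae_restrict_mem measurableSet_Ioi] with q hq
      have hq' : 0 < q := hq
      rw [← (inner_int hp₂ hq'.le).2, ← integral_const_mul]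
      apply setIntegral_congr_fun measurableSet_Ioi
      intro t ht
      have ht' : 0 < t := ht
      simp only
      rw [hmul, Real.norm_of_nonneg (by positivity)]
  refine ⟨by rw [IntegrableOn, hvol]; exact hint, ?_⟩
  rw [hvol, integral_prod _ hint, ← o2]
  apply setIntegral_congr_fun measurableSet_Ioi
  intro q hq
  simp only [hmul]
  rw [integral_const_mul, (inner_int hp₂ (le_of_lt hq)).2]
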